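/- Let g be a finite-dimensional Lie algebra over F, μ ∈ ℕ^ℓ, and A = F[t₁,…,t_ℓ]/⟨t^ω : ω ≰ μ⟩. Then the index of the Lie algebra g⊗A satisfies χ(g⊗A) = χ(g)·dim_F A. -/

import Mathlib

open scoped TensorProduct

/-- The ideal `⟨t^ω : ω ≰ μ⟩` of `F[t₁,…,t_ℓ]`. -/
noncomputable def truncIdeal (F : Type*) [Field F] {ℓ : ℕ} (μ : Fin ℓ → ℕ) :
    Ideal (MvPolynomial (Fin ℓ) F) :=
  Ideal.span ((fun ω : Fin ℓ → ℕ =>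
    MvPolynomial.monomial (Finsupp.equivFunOnFinite.symm ω) (1 : F)) '' {ω | ¬ ω ≤ μ})

/-- The truncated polynomial algebra `A = F[t₁,…,t_ℓ]/⟨t^ω : ω ≰ μ⟩`. -/
noncomputable abbrev trunc (F : Type*) [Field F] {ℓ : ℕ} (μ : Fin ℓ → ℕ) : Type _ :=
  MvPolynomial (Fin ℓ) F ⧸ truncIdeal F μ

/-- The Lie algebra structure over `F` on `A ⊗[F] g` (restricting scalars in the canonical
`A`-Lie algebra structure, so that `⁅a ⊗ x, b ⊗ y⁆ = ab ⊗ ⁅x, y⁆`). -/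
noncomputable instance tensorLieAlgebra {F : Type*} [Field F] {A : Type*} [CommRing A]
    [Algebra F A] {g : Type*} [LieRing g] [LieAlgebra F g] :
    LieAlgebra F (A ⊗[F] g) where
  lie_smul t x y := by
    rw [← algebraMap_smul A t y, lie_smul, algebraMap_smul]

/-- For a Lie algebra `a` over `F` and a linear form `f ∈ a*`, the stabilizer
`a^f = {x ∈ a : f([a, x]) = 0}`. -/
noncomputable def formStab (F : Type*) [Field F] (L : Type*) [LieRing L] [LieAlgebra F L]
    (f : Module.Dual F L) : Submodule F L where
  carrier := {x | ∀ y : L, f ⁅y, x⁆ = 0}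
  add_mem' := by
    intro a b ha hb y
    rw [lie_add, map_add, ha y, hb y, add_zero]
  zero_mem' := by
    intro y
    rw [lie_zero, map_zero]
  smul_mem' := by
    intro c a ha y
    rw [lie_smul, map_smul, ha y, smul_zero]

/-- The index `χ(a) = min_{f ∈ a*} dim a^f` of a finite-dimensional Lie algebra `a`. -/
noncomputable def lieIndex (F : Type*) [Field F] (L : Type*) [LieRing L]
    [LieAlgebra F L] : ℕ :=
  sInf (Set.range fun f : Module.Dual F L => Module.finrank F (formStab F L f))

section helpers

open Polynomial

lemma rank_semicont {F : Type*} [Field F] [Infinite F] {m : Type*} [Fintype m] [DecidableEq m]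
    (P : Matrix m m F[X]) (R : ℕ)
    (h : ∀ s : F, s ≠ 0 → (P.map (eval s)).rank ≤ R) : (P.map (eval 0)).rank ≤ R := by
  obtain ⟨k, hk, V, U, e, hVU⟩ : ∃ k : ℕ, (P.map (eval (0 : F))).rank = k ∧
      ∃ (V U : Matrix m m F) (e : m ≃ Fin k ⊕ Fin (Fintype.card m - k)),
      V * P.map (eval 0) * U = (Matrix.fromBlocks 1 0 0 0).submatrix e e := by
    obtain ⟨V, U, e, -, -, hVU⟩ := Matrix.exists_rank_normal_form (P.map (eval (0 : F)))
    exact ⟨_, rfl, V, U, e, hVU⟩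
  rw [hk]
  let N : Matrix (Fin k) (Fin k) F[X] :=
    (V.map C * P * U.map C).submatrix (fun i => e.symm (Sum.inl i)) (fun i => e.symm (Sum.inl i))
  have hN : ∀ s : F, N.map (eval s) = (V * P.map (eval s) * U).submatrix
      (fun i => e.symm (Sum.inl i)) (fun i => e.symm (Sum.inl i)) := by
    intro s
    ext i j
    simp [N, Matrix.mul_apply, eval_finsetSum]
  have hdet : ∀ s : F, N.det.eval s = (N.map (eval s)).det := by
    intro s
    have := RingHom.map_det (evalRingHom s) N
    simpa using this
  have h0 : N.det.eval 0 = 1 := by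
    rw [hdet, hN, hVU]
    have h1 : ((Matrix.fromBlocks 1 0 0 0 : Matrix (Fin k ⊕ Fin (Fintype.card m - k)) _ F).submatrix
        e e).submatrix (fun i => e.symm (Sum.inl i)) (fun i => e.symm (Sum.inl i))
        = (1 : Matrix (Fin k) (Fin k) F) := by
      ext i j
      simp
    rw [h1, Matrix.det_one]
  have hne : X * N.det ≠ 0 := by
    refine mul_ne_zero X_ne_zero ?_
    rintro h1
    simp [h1] at h0
  obtain ⟨s, hs⟩ : ∃ s : F, (X * N.det).eval s ≠ 0 := by
    by_contra! hcon
    exact hne (Polynomial.funext (by simpa using hcon))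
  rw [eval_mul, eval_X] at hs
  have hs0 : s ≠ 0 := left_ne_zero_of_mul hs
  have hs1 : (N.map (eval s)).det ≠ 0 := by rw [← hdet]; exact right_ne_zero_of_mul hs
  have h2 := Matrix.rank_of_det_ne_zero hs1
  rw [Fintype.card_fin, hN] at h2
  calc k = _ := h2.symm
    _ ≤ (V * P.map (eval s) * U).rank := Matrix.rank_submatrix_le _ _ _
    _ ≤ (V * P.map (eval s)).rank := Matrix.rank_mul_le_left _ _
    _ ≤ (P.map (eval s)).rank := Matrix.rank_mul_le_right _ _
    _ ≤ R := h s hs0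

lemma rank_add_le' {F : Type*} [Field F] {m : Type*} [Fintype m]
    (A B : Matrix m m F) : (A + B).rank ≤ A.rank + B.rank := by
  unfold Matrix.rank
  rw [Matrix.mulVecLin_add]
  refine (Submodule.finrank_mono (LinearMap.range_add_le _ _)).trans ?_
  exact Submodule.finrank_add_le_finrank_add_finrank _ _

lemma rank_sum_le' {F : Type*} [Field F] {m κ : Type*} [Fintype m]
    (s : Finset κ) (A : κ → Matrix m m F) (r : ℕ) (h : ∀ p, (A p).rank ≤ r) :
    (∑ p ∈ s, A p).rank ≤ s.card * r := by
  classical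
  induction s using Finset.induction_on with
  | empty => simp
  | insert a s ha ih =>
    rw [Finset.sum_insert ha, Finset.card_insert_of_notMem ha]
    have := rank_add_le' (A a) (∑ p ∈ s, A p)
    have := h a
    linarith

/-- Gram matrix of the form `f[·,·]`. -/
def gram {F : Type*} [Field F] {L : Type*} [LieRing L] [LieAlgebra F L] {ι : Type*}
    (b : ι → L) (f : Module.Dual F L) : Matrix ι ι F := fun i j => f ⁅b i, b j⁆

lemma stab_rank {F : Type*} [Field F] {L : Type*} [LieRing L] [LieAlgebra F L] {ι : Type*}
    [Fintype ι] [DecidableEq ι] (b : Module.Basis ι F L) (f : Module.Dual F L) :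
    Module.finrank F (formStab F L f) + (gram b f).rank = Fintype.card ι := by
  have h1 := LinearMap.finrank_range_add_finrank_ker (gram b f).mulVecLin
  rw [Module.finrank_fintype_fun_eq_card] at h1
  have h2 : formStab F L f =
      (LinearMap.ker (gram b f).mulVecLin).comap (b.equivFun : L →ₗ[F] (ι → F)) := by
    ext x
    have key : ∀ i, f ⁅b i, x⁆ = ((gram b f).mulVec (b.equivFun x)) i := by
      intro i
      conv_lhs => rw [← b.sum_repr x, lie_sum, map_sum]
      simp [Matrix.mulVec, dotProduct, gram, mul_comm]
    constructor
    · intro hx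
      simp only [Submodule.mem_comap, LinearMap.mem_ker, Matrix.mulVecLin_apply]
      ext i
      exact (key i).symm.trans (hx _)
    · intro hx y
      simp only [Submodule.mem_comap, LinearMap.mem_ker, Matrix.mulVecLin_apply] at hx
      have hz : ∀ i, f ⁅b i, x⁆ = 0 := fun i => (key i).trans (congrFun hx i)
      rw [← b.sum_repr y, sum_lie, map_sum]
      simp [hz]
  have h3 : Module.finrank F (formStab F L f)
      = Module.finrank F (LinearMap.ker (gram b f).mulVecLin) := by
    rw [h2]
    exact LinearEquiv.finrank_eq (LinearEquiv.ofSubmodule' _ _)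
  unfold Matrix.rank
  omega

lemma oneVar (F : Type*) [Field F] [CharZero F] (m : ℕ) :
    ∃ H : Fin (m+1) → Fin (m+1) → Fin (m+1) → F[X],
      (∀ k i j, eval 0 (H k i j) = if (i : ℕ) + j = k then 1 else 0) ∧
      ∀ s : F, s ≠ 0 → ∃ β u : Fin (m+1) → Fin (m+1) → F, ∀ k i j,
        eval s (H k i j) = ∑ p, β k p * (u p i * u p j) := by
  let v : Fin (m+1) → F := fun p => ((p : ℕ) : F)
  have hv : (Matrix.vandermonde v).det ≠ 0 := by
    rw [Matrix.det_vandermonde_ne_zero_iff]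
    intro a b hab
    exact Fin.ext (Nat.cast_injective hab)
  let α := (Matrix.vandermonde v)⁻¹
  have hα : α * Matrix.vandermonde v = 1 := Matrix.nonsing_inv_mul _ (IsUnit.mk0 _ hv)
  let c : Fin (m+1) → ℕ → F := fun k n => ∑ p, α k p * v p ^ n
  have hc : ∀ (k : Fin (m+1)) (n : ℕ), n ≤ m → c k n = if n = k then 1 else 0 := by
    intro k n hn
    have := congrFun (congrFun hα k) ⟨n, by omega⟩
    rw [Matrix.mul_apply] at this
    simp only [Matrix.vandermonde_apply, Matrix.one_apply] at this
    simp only [c]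
    rw [this]
    congr 1
    rw [Fin.ext_iff]
    exact propext eq_comm
  refine ⟨fun k i j => C (c k (i+j)) * X ^ ((i : ℕ) + j - k), ?_, ?_⟩
  · intro k i j
    have hk := k.2
    beta_reduce
    rcases lt_trichotomy ((i : ℕ) + j) k with h | h | h
    · rw [hc k _ (by omega), if_neg (by omega)]; simp
    · rw [hc k _ (by omega), if_pos h, h]; simp
    · rw [if_neg (by omega)]
      have : (i : ℕ) + j - k ≠ 0 := by omega
      simp [this]
  · intro s hs
    refine ⟨fun k p => α k p / s ^ (k : ℕ), fun p i => (s * v p) ^ (i : ℕ), fun k i j => ?_⟩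
    have hk := k.2
    have e1 : ∑ p, α k p / s ^ (k : ℕ) * ((s * v p) ^ (i : ℕ) * (s * v p) ^ (j : ℕ))
        = c k (i + j) * (s ^ ((i : ℕ) + j) / s ^ (k : ℕ)) := by
      simp only [c]
      rw [Finset.sum_mul]
      refine Finset.sum_congr rfl fun p _ => ?_
      rw [← pow_add, mul_pow]
      ring
    rw [e1]
    simp only [eval_mul, eval_C, eval_pow, eval_X]
    rcases lt_or_ge ((i : ℕ) + j) k with h | h
    · rw [hc k _ (by omega), if_neg (by omega)]; simp
    · rw [pow_sub₀ _ hs h, div_eq_mul_inv]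

lemma multiVar (F : Type*) [Field F] [CharZero F] {ℓ : ℕ} (μ : Fin ℓ → ℕ) :
    ∃ H : (∀ x, Fin (μ x + 1)) → (∀ x, Fin (μ x + 1)) → (∀ x, Fin (μ x + 1)) → F[X],
      (∀ k i j, eval 0 (H k i j) = if ∀ x, (i x : ℕ) + j x = k x then 1 else 0) ∧
      ∀ s : F, s ≠ 0 → ∃ β u : (∀ x, Fin (μ x + 1)) → (∀ x, Fin (μ x + 1)) → F, ∀ k i j,
        eval s (H k i j) = ∑ p, β k p * (u p i * u p j) := by
  choose H h0 h1 using fun x => oneVar F (μ x)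
  refine ⟨fun k i j => ∏ x, H x (k x) (i x) (j x), ?_, ?_⟩
  · intro k i j
    rw [eval_prod]
    simp only [h0]
    rw [Finset.prod_ite_zero]
    simp
  · intro s hs
    choose β u hu using fun x => h1 x s hs
    refine ⟨fun k p => ∏ x, β x (k x) (p x), fun p i => ∏ x, u x (p x) (i x), fun k i j => ?_⟩
    rw [eval_prod]
    simp only [hu]
    rw [Finset.prod_univ_sum]
    simp only [Fintype.piFinset_univ, Finset.prod_mul_distrib]

lemma rank_lower {F : Type*} [Field F] [CharZero F] {A : Type*} [CommRing A] [Algebra F A]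
    {g : Type*} [LieRing g] [LieAlgebra F g] {κ ι : Type*} [Fintype κ] [DecidableEq κ]
    [Fintype ι] [DecidableEq ι] (e : Module.Basis κ F A) (b : Module.Basis ι F g)
    (H : κ → κ → κ → F[X])
    (h0 : ∀ k i j, eval 0 (H k i j) = e.repr (e i * e j) k)
    (h1 : ∀ s : F, s ≠ 0 → ∃ β u : κ → κ → F, ∀ k i j,
        eval s (H k i j) = ∑ p, β k p * (u p i * u p j))
    (r : ℕ) (hr : ∀ h : Module.Dual F g, (gram b h).rank ≤ r)
    (f : Module.Dual F (A ⊗[F] g)) :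
    (gram (e.tensorProduct b) f).rank ≤ Fintype.card κ * r := by
  let P : Matrix (κ × ι) (κ × ι) F[X] := Matrix.of fun x y =>
    ∑ k, H k x.1 y.1 * C (f (e k ⊗ₜ ⁅b x.2, b y.2⁆))
  have hP0 : gram (e.tensorProduct b) f = P.map (eval 0) := by
    ext x y
    simp only [gram, Matrix.map_apply, P, Matrix.of_apply, eval_finsetSum,
      eval_mul, eval_C, h0, Module.Basis.tensorProduct_apply']
    rw [LieAlgebra.ExtendScalars.bracket_tmul]
    conv_lhs => rw [← e.sum_repr (e x.1 * e y.1), TensorProduct.sum_tmul, map_sum]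
    refine Finset.sum_congr rfl fun k _ => ?_
    rw [← TensorProduct.smul_tmul', map_smul, smul_eq_mul]
  rw [hP0]
  refine rank_semicont P _ fun s hs => ?_
  obtain ⟨β, u, hu⟩ := h1 s hs
  let hp : κ → Module.Dual F g := fun p => ∑ k, β k p • (f ∘ₗ TensorProduct.mk F A g (e k))
  let U : κ → Matrix (κ × ι) ι F := fun p => Matrix.of fun x i => if x.2 = i then u p x.1 else 0
  have hs' : P.map (eval s) = ∑ p, U p * gram b (hp p) * (U p).transpose := by
    ext x y
    simp only [Matrix.map_apply, P, Matrix.of_apply, eval_finsetSum, eval_mul, eval_C, hu, Matrix.sum_apply]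
    simp only [Finset.sum_mul]
    rw [Finset.sum_comm]
    refine Finset.sum_congr rfl fun p _ => ?_
    simp only [Matrix.mul_apply, U, Matrix.of_apply, Matrix.transpose_apply, ite_mul, mul_ite, zero_mul, mul_zero,
      Finset.sum_ite_eq, Finset.mem_univ, if_true, gram, hp]
    simp only [LinearMap.sum_apply, LinearMap.smul_apply, LinearMap.comp_apply,
      TensorProduct.mk_apply, smul_eq_mul, Finset.mul_sum, Finset.sum_mul]
    refine Finset.sum_congr rfl fun k _ => ?_
    ring
  rw [hs']
  refine (rank_sum_le' Finset.univ _ r fun p => ?_).trans (by simp)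
  exact ((Matrix.rank_mul_le_left _ _).trans (Matrix.rank_mul_le_right _ _)).trans (hr _)

lemma stab_upper {F : Type*} [Field F] {A : Type*} [CommRing A] [Algebra F A]
    {g : Type*} [LieRing g] [LieAlgebra F g] [FiniteDimensional F g] {κ : Type*} [Fintype κ]
    [DecidableEq κ] (e : Module.Basis κ F A) (lam : Module.Dual F A) (σ : κ → κ)
    (hσ : ∀ i j, lam (e (σ i) * e j) = if i = j then 1 else 0) (f₀ : Module.Dual F g) :
    ∃ f : Module.Dual F (A ⊗[F] g), Module.finrank F (formStab F (A ⊗[F] g) f)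
      ≤ Module.finrank F (formStab F g f₀) * Fintype.card κ := by
  let co : κ → (A ⊗[F] g →ₗ[F] g) := fun k =>
    (TensorProduct.lid F g).toLinearMap ∘ₗ LinearMap.rTensor g (e.coord k)
  let f : Module.Dual F (A ⊗[F] g) :=
    f₀ ∘ₗ (TensorProduct.lid F g).toLinearMap ∘ₗ LinearMap.rTensor g lam
  have hlam : ∀ k a, lam (e (σ k) * a) = e.repr a k := by
    intro k a
    conv_lhs => rw [← e.sum_repr a, Finset.mul_sum, map_sum]
    simp [hσ]
  have key : ∀ (k : κ) (y : g) (x : A ⊗[F] g), f ⁅e (σ k) ⊗ₜ[F] y, x⁆ = f₀ ⁅y, co k x⁆ := by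
    intro k y x
    induction x using TensorProduct.induction_on with
    | zero => simp
    | tmul a z =>
      rw [LieAlgebra.ExtendScalars.bracket_tmul]
      simp [f, co, hlam]
    | add x y hx hy => rw [lie_add, map_add, map_add, lie_add, map_add, hx, hy]
  have hsum : ∀ x, ∑ k, e k ⊗ₜ[F] co k x = x := by
    intro x
    induction x using TensorProduct.induction_on with
    | zero => simp
    | tmul a z =>
      conv_rhs => rw [← e.sum_repr a, TensorProduct.sum_tmul]
      simp [co, TensorProduct.smul_tmul]
    | add x y hx hy =>
      conv_rhs => rw [← hx, ← hy, ← Finset.sum_add_distrib]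
      simp [TensorProduct.tmul_add]
  refine ⟨f, ?_⟩
  have hmem : ∀ k (x : formStab F (A ⊗[F] g) f), co k x ∈ formStab F g f₀ := by
    intro k x y
    rw [← key]
    exact x.2 _
  let T : formStab F (A ⊗[F] g) f →ₗ[F] (κ → formStab F g f₀) :=
    LinearMap.pi fun k => ((co k) ∘ₗ (formStab F (A ⊗[F] g) f).subtype).codRestrict _ (hmem k)
  have hT : Function.Injective T := by
    intro x y hxy
    apply Subtype.ext
    rw [← hsum x, ← hsum y]
    refine Finset.sum_congr rfl fun k _ => ?_
    have := congrArg Subtype.val (congrFun hxy k)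
    have h' : co k x = co k y := this
    rw [h']
  have := LinearMap.finrank_le_finrank_of_injective hT
  rw [Module.finrank_pi_fintype] at this
  simpa [mul_comm] using this

/-- exponent -/
noncomputable def expo {ℓ : ℕ} {μ : Fin ℓ → ℕ} (k : ∀ x, Fin (μ x + 1)) : Fin ℓ →₀ ℕ :=
  Finsupp.equivFunOnFinite.symm fun x => (k x : ℕ)

lemma mem_truncIdeal {F : Type*} [Field F] {ℓ : ℕ} (μ : Fin ℓ → ℕ)
    (p : MvPolynomial (Fin ℓ) F) :
    p ∈ truncIdeal F μ ↔ ∀ k : (∀ x, Fin (μ x + 1)), p.coeff (expo k) = 0 := by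
  have : truncIdeal F μ = Ideal.span ((fun s => MvPolynomial.monomial s (1 : F)) ''
      {s : Fin ℓ →₀ ℕ | ¬ (s : Fin ℓ → ℕ) ≤ μ}) := by
    unfold truncIdeal
    congr 1
    ext q
    constructor
    · rintro ⟨ω, h, rfl⟩
      exact ⟨_, by simpa using h, rfl⟩
    · rintro ⟨ω, h, rfl⟩
      exact ⟨ω, h, by simp⟩
  rw [this, MvPolynomial.mem_ideal_span_monomial_image]
  constructor
  · intro h k
    by_contra hk
    obtain ⟨si, hsi, hle⟩ := h _ (MvPolynomial.mem_support_iff.mpr hk)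
    apply hsi
    intro x
    have h1 := hle x
    have h2 := (k x).2
    simp only [expo, Finsupp.equivFunOnFinite_symm_apply_apply] at h1
    show si x ≤ μ x
    omega
  · intro h xi hxi
    refine ⟨xi, ?_, le_rfl⟩
    intro hle
    apply MvPolynomial.mem_support_iff.mp hxi
    have := h (fun x => ⟨xi x, Nat.lt_succ_of_le (hle x)⟩)
    convert this
    ext x
    simp [expo]

lemma trunc_basis (F : Type*) [Field F] {ℓ : ℕ} (μ : Fin ℓ → ℕ) :
    ∃ e : Module.Basis (∀ x, Fin (μ x + 1)) F (trunc F μ),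
      ∀ i j k, e.repr (e i * e j) k = if ∀ x, (i x : ℕ) + j x = k x then 1 else 0 := by
  classical
  let ε : (∀ x, Fin (μ x + 1)) → Module.Dual F (trunc F μ) := fun k =>
    Submodule.liftQ ((truncIdeal F μ).restrictScalars F) (MvPolynomial.lcoeff F (expo k))
      (fun p hp => (mem_truncIdeal μ p).mp hp k)
  have hε : ∀ k p, ε k (Ideal.Quotient.mk _ p) = p.coeff (expo k) := fun k p => rfl
  let m : (∀ x, Fin (μ x + 1)) → trunc F μ := fun k =>
    Ideal.Quotient.mk _ (MvPolynomial.monomial (expo k) 1)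
  have hinj : ∀ k k' : (∀ x, Fin (μ x + 1)), expo k = expo k' ↔ k = k' := by
    intro k k'
    constructor
    · intro h
      funext x
      have := DFunLike.congr_fun h x
      exact Fin.ext (by simpa [expo] using this)
    · rintro rfl; rfl
  have hD : Module.DualBases m ε := by
    refine ⟨fun k => ?_, fun k k' h => ?_, fun {p q} h => ?_, fun _ => Set.toFinite _⟩
    · simp [m, hε]
    · simp only [m, hε, MvPolynomial.coeff_monomial]
      rw [if_neg]
      rw [hinj]
      exact h.symm
    · obtain ⟨p, rfl⟩ := Ideal.Quotient.mk_surjective p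
      obtain ⟨q, rfl⟩ := Ideal.Quotient.mk_surjective q
      rw [Ideal.Quotient.eq, mem_truncIdeal]
      intro k
      have := h k
      rw [hε, hε] at this
      rw [MvPolynomial.coeff_sub, this, sub_self]
  refine ⟨hD.basis, fun i j k => ?_⟩
  rw [hD.coe_basis, hD.basis_repr_apply, Module.DualBases.coeffs_apply]
  simp only [m]
  rw [← map_mul, hε, MvPolynomial.monomial_mul, MvPolynomial.coeff_monomial]
  congr 1
  · rw [Finsupp.ext_iff]
    simp [expo]
  · simp

end helpers

/-- Let `g` be a finite-dimensional Lie algebra over a field `F` of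
characteristic zero, `μ ∈ ℕ^ℓ`, and `A = F[t₁,…,t_ℓ]/⟨t^ω : ω ≰ μ⟩`.  Then the index of
the Lie algebra `g ⊗ A` satisfies `χ(g ⊗ A) = χ(g) · dim_F A`. -/
theorem statement8 {F : Type*} [Field F] [CharZero F]
    {g : Type*} [LieRing g] [LieAlgebra F g] [FiniteDimensional F g]
    {ℓ : ℕ} (μ : Fin ℓ → ℕ) :
    lieIndex F (trunc F μ ⊗[F] g) = lieIndex F g * Module.finrank F (trunc F μ) := by
  classical
  obtain ⟨e, he⟩ := trunc_basis F μ
  obtain ⟨H, h0, h1⟩ := multiVar F μ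
  have b := Module.finBasis F g
  rw [Module.finrank_eq_card_basis e]
  obtain ⟨f₀, hf₀⟩ : lieIndex F g ∈ Set.range _ := Nat.sInf_mem (Set.range_nonempty _)
  apply le_antisymm
  · let top : (∀ x, Fin (μ x + 1)) := fun x => Fin.last _
    obtain ⟨f, hf⟩ := stab_upper e (e.coord top) (fun k x => Fin.rev (k x)) (by
      intro i j
      rw [Module.Basis.coord_apply, he]
      congr 1
      rw [funext_iff, eq_iff_iff]
      refine forall_congr' fun x => ?_
      have := (i x).2
      have := (j x).2
      rw [Fin.ext_iff]
      simp only [Fin.val_rev, top, Fin.val_last]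
      omega) f₀
    rw [← hf₀]
    have h2 : lieIndex F (trunc F μ ⊗[F] g) ≤
        Module.finrank F (formStab F (trunc F μ ⊗[F] g) f) := Nat.sInf_le ⟨f, rfl⟩
    exact h2.trans hf
  · refine le_csInf (Set.range_nonempty _) ?_
    rintro _ ⟨f, rfl⟩
    have hr : ∀ h : Module.Dual F g,
        (gram b h).rank ≤ Module.finrank F g - lieIndex F g := by
      intro h
      have h2 := stab_rank b h
      have h3 : lieIndex F g ≤ Module.finrank F (formStab F g h) := Nat.sInf_le ⟨h, rfl⟩
      rw [Fintype.card_fin] at h2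
      omega
    have h4 := rank_lower e b H (fun k i j => by rw [h0, he]) h1 _ hr f
    have h5 := stab_rank (e.tensorProduct b) f
    rw [Fintype.card_prod, Fintype.card_fin] at h5
    have h6 : lieIndex F g ≤ Module.finrank F g := by
      rw [← hf₀]; exact Submodule.finrank_le _
    obtain ⟨d, hd⟩ := Nat.exists_eq_add_of_le h6
    have h7 : Module.finrank F g - lieIndex F g = d := by omega
    rw [h7] at h4
    have h8 := congrArg (fun t => Fintype.card (∀ x, Fin (μ x + 1)) * t) hd
    simp only [mul_add] at h8
    show _ ≤ Module.finrank F (formStab F (trunc F μ ⊗[F] g) f)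
    nlinarith
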